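/- Let q > 2 be a prime power and k a positive integer. For any a₁,…,a_k ∈ 𝔽_q, setting (b₁,…,b_k) := F(a₁,…,a_k), the following identity holds as permutations of ℙ¹(𝔽_q): ι ∘ τ_{a_k} ∘ ι ∘ τ_{a_{k−1}} ∘ ⋯ ∘ ι ∘ τ_{a₁} = ν ∘ (b₁,∞) ∘ (b₂,∞) ∘ ⋯ ∘ (b_k,∞), where ν := Inv ∘ τ_{a_k} ∘ Inv ∘ τ_{a_{k−1}} ∘ ⋯ ∘ Inv ∘ τ_{a₁} (a permutation induced by a degree-one rational function). -/

import Mathlib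

/-- The sequence `c_{i,j}` from the paper: `c_{i,0} = 0` and
`c_{i,j} = c_{i,j-1}^{q-2} + a_{i-j+1}` (indices of `a` are 0-based here). -/
def cRec {F : Type*} [Field F] (q : ℕ) {k : ℕ} (a : Fin k → F) (i : Fin k) : ℕ → F
  | 0 => 0
  | j + 1 => (cRec q a i j) ^ (q - 2)
      + a ⟨i.val - j, lt_of_le_of_lt (Nat.sub_le _ _) i.isLt⟩

/-- The map F : 𝔽_q^k → 𝔽_q^k, sending (a₁,…,a_k) to (c_{1,1},…,c_{k,k}). -/
def Fvec {F : Type*} [Field F] (q : ℕ) {k : ℕ} (a : Fin k → F) : Fin k → F :=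
  fun i => cRec q a i (i.val + 1)

theorem pow_card_sub_two_eq_inv {F : Type*} [Field F] [Fintype F] (hq : 2 < Fintype.card F)
    (x : F) : x ^ (Fintype.card F - 2) = x⁻¹ := by
  by_cases hx : x = 0
  · rw [hx, inv_zero, zero_pow (by omega)]
  · refine eq_inv_of_mul_eq_one_left ?_
    rw [← pow_succ, show Fintype.card F - 2 + 1 = Fintype.card F - 1 by omega,
      FiniteField.pow_card_sub_one_eq_one x hx]

theorem cRec_comp_castSucc {F : Type*} [Field F] (q : ℕ) {k : ℕ} (a : Fin (k + 1) → F)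
    (i : Fin k) (j : ℕ) : cRec q (fun t => a t.castSucc) i j = cRec q a i.castSucc j := by
  induction j with
  | zero => rfl
  | succ j ih => simp only [cRec, ih]; rfl

/-- If `ι` fixes `∞`, then so does every product of `ι`s and translations. -/
theorem prod_ofFn_mul_subRight_none {F : Type*} [Field F] (ι : Equiv.Perm (Option F))
    (hι_infty : ι none = none) {n : ℕ} (b : Fin n → F) :
    (List.ofFn (fun i : Fin n => ι * (Equiv.subRight (b i)).optionCongr)).prod none = none := by
  induction n with
  | zero => simp
  | succ n ih =>
    rw [List.ofFn_succ, List.prod_cons, Equiv.Perm.mul_apply, ih (fun i => b i.succ)]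
    simp [hι_infty]

/-- Applying the first `n` factors to `c_{i,i}` (in the paper's indexing) unwinds `n` steps
of the recursion. -/
theorem prod_ofFn_apply_cRec {F : Type*} [Field F] [Fintype F] (hq : 2 < Fintype.card F)
    (ι : Equiv.Perm (Option F))
    (hι : ∀ a : F, ι (some a) = some (a ^ (Fintype.card F - 2)))
    {k : ℕ} (a : Fin k → F) (i : Fin k) (n : ℕ) (hn : n ≤ i.val) :
    (List.ofFn (fun t : Fin n =>
        ι * (Equiv.subRight (a (t.rev.castLE (hn.trans i.isLt.le)))).optionCongr)).prod
        (some (cRec (Fintype.card F) a i (i.val + 1)))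
      = some (cRec (Fintype.card F) a i (i.val + 1 - n)) := by
  induction n with
  | zero => simp
  | succ n ih =>
    have hrev (t : Fin n) : (t.succ.rev.castLE (hn.trans i.isLt.le) : Fin k)
        = t.rev.castLE ((Nat.le_of_succ_le hn).trans i.isLt.le) := by
      ext; simp
    rw [List.ofFn_succ, List.prod_cons, Equiv.Perm.mul_apply]
    simp only [hrev]
    rw [ih (Nat.le_of_succ_le hn), show i.val + 1 - n = (i.val - n) + 1 by omega,
      show i.val + 1 - (n + 1) = i.val - n by omega]
    have hidx : (⟨i.val - (i.val - n), lt_of_le_of_lt (Nat.sub_le _ _) i.isLt⟩ : Fin k)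
        = (0 : Fin (n + 1)).rev.castLE (hn.trans i.isLt.le) := by
      ext; simp; omega
    simp [cRec, hidx, hι, pow_card_sub_two_eq_inv hq]

theorem eq_mul_swap_zero_infty {F : Type*} [Field F] [Fintype F] [DecidableEq F]
    (hq : 2 < Fintype.card F)
    (ι : Equiv.Perm (Option F)) (hι_infty : ι none = none)
    (hι : ∀ a : F, ι (some a) = some (a ^ (Fintype.card F - 2)))
    (Inv : Equiv.Perm (Option F)) (hInv_infty : Inv none = some 0)
    (hInv_zero : Inv (some 0) = none)
    (hInv : ∀ a : F, a ≠ 0 → Inv (some a) = some a⁻¹) :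
    ι = Inv * Equiv.swap (some 0) none := by
  ext1 x
  rw [Equiv.Perm.mul_apply]
  rcases x with _ | x
  · rw [Equiv.swap_apply_right, hι_infty, hInv_zero]
  · rw [hι, pow_card_sub_two_eq_inv hq]
    by_cases hx : x = 0
    · rw [hx, Equiv.swap_apply_left, hInv_infty, inv_zero]
    · rw [Equiv.swap_apply_of_ne_of_ne (by simpa using hx) (by simp), hInv x hx]

/-- For a₁,…,a_k ∈ 𝔽_q and (b₁,…,b_k) := F(a₁,…,a_k),
ι ∘ τ_{a_k} ∘ ⋯ ∘ ι ∘ τ_{a₁} = ν ∘ (b₁,∞) ∘ ⋯ ∘ (b_k,∞) as permutations of ℙ¹(𝔽_q)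
(modeled as `Option F` with `none` as ∞), where
ν = Inv ∘ τ_{a_k} ∘ Inv ∘ τ_{a_{k−1}} ∘ ⋯ ∘ Inv ∘ τ_{a₁}. -/
theorem alg_to_comb_recipe
    {F : Type*} [Field F] [Fintype F] [DecidableEq F]
    (hq : 2 < Fintype.card F) (k : ℕ) (hk : 0 < k)
    (ι : Equiv.Perm (Option F))
    (hι_infty : ι none = none)
    (hι : ∀ a : F, ι (some a) = some (a ^ (Fintype.card F - 2)))
    (Inv : Equiv.Perm (Option F))
    (hInv_infty : Inv none = some 0)
    (hInv_zero : Inv (some 0) = none)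
    (hInv : ∀ a : F, a ≠ 0 → Inv (some a) = some a⁻¹)
    (a : Fin k → F) :
    (List.ofFn (fun i : Fin k => ι * (Equiv.subRight (a i.rev)).optionCongr)).prod
      = (List.ofFn (fun i : Fin k => Inv * (Equiv.subRight (a i.rev)).optionCongr)).prod
        * (List.ofFn (fun i : Fin k =>
            Equiv.swap (some (Fvec (Fintype.card F) a i)) none)).prod := by
  clear hk
  induction k with
  | zero => simp
  | succ k ih =>
    have ih' := ih (fun t => a t.castSucc)
    rw [List.ofFn_succ, List.ofFn_succ (f := fun i : Fin (k + 1) => Inv * _),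
      List.ofFn_succ' (f := fun i : Fin (k + 1) => Equiv.swap _ _), List.concat_eq_append,
      List.prod_append, List.prod_cons, List.prod_cons, List.prod_singleton]
    simp only [Fin.rev_succ, Fin.rev_zero]
    have hF (i : Fin k) : Fvec (Fintype.card F) a i.castSucc
        = Fvec (Fintype.card F) (fun t => a t.castSucc) i :=
      (cRec_comp_castSucc _ a i _).symm
    simp only [hF]
    rw [mul_assoc _ (List.prod _), ← mul_assoc (List.prod _) (List.prod _), ← ih']
    set A := (List.ofFn fun i : Fin k =>
      ι * (Equiv.subRight (a i.rev.castSucc)).optionCongr).prod with hA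
    have hA_none : A none = none := prod_ofFn_mul_subRight_none ι hι_infty _
    have hA_some : A (some (Fvec (Fintype.card F) a (Fin.last k))) = some (a (Fin.last k)) := by
      refine (prod_ofFn_apply_cRec hq ι hι a (Fin.last k) k le_rfl).trans ?_
      have h0 : Fintype.card F - 2 ≠ 0 := by omega
      simp [cRec, h0, Fin.last]
    have hswap : A * Equiv.swap (some (Fvec (Fintype.card F) a (Fin.last k))) none
        = Equiv.swap (some (a (Fin.last k))) none * A := by
      rw [Equiv.mul_swap_eq_swap_mul, hA_some, hA_none]
    have htrans : (Equiv.subRight (a (Fin.last k))).optionCongr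
          * Equiv.swap (some (a (Fin.last k))) none
        = Equiv.swap (some 0) none * (Equiv.subRight (a (Fin.last k))).optionCongr := by
      rw [Equiv.mul_swap_eq_swap_mul]
      simp
    rw [hswap, mul_assoc Inv, ← mul_assoc _ (Equiv.swap _ _) A, htrans, ← mul_assoc, ← mul_assoc,
      ← eq_mul_swap_zero_infty hq ι hι_infty hι Inv hInv_infty hInv_zero hInv]
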